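/- If u_ε → u₀ in H¹(Ω) as ε → 0⁺, then ε⁻² ∫_Ω (1 − |u_ε|²)² dx → 0 as ε → 0⁺. -/

import Mathlib

open MeasureTheory Filter Topology

noncomputable section

/-- Points of the plane, viewed as the Euclidean space `ℝ²`. -/
abbrev Pt : Type := EuclideanSpace ℝ (Fin 2)

/-- The `i`-th partial derivative of a complex-valued function. -/
def pd (u : Pt → ℂ) (x : Pt) (i : Fin 2) : ℂ :=
  fderiv ℝ u x (EuclideanSpace.single i 1)

/-- Squared Hilbert–Schmidt norm of the derivative, `|∇u|²`. -/
def gradSq (u : Pt → ℂ) (x : Pt) : ℝ :=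
  ∑ i, ‖pd u x i‖ ^ 2

/-- `|∇u − ∇v|²`. -/
def gradDiffSq (u v : Pt → ℂ) (x : Pt) : ℝ :=
  ∑ i, ‖pd u x i - pd v x i‖ ^ 2

/-- Laplacian of a complex-valued function. -/
def lap (u : Pt → ℂ) (x : Pt) : ℂ :=
  ∑ i, fderiv ℝ (fun y => pd u y i) x (EuclideanSpace.single i 1)

/-- The `i`-th partial derivative of a real-valued function. -/
def pdR (f : Pt → ℝ) (x : Pt) (i : Fin 2) : ℝ :=
  fderiv ℝ f x (EuclideanSpace.single i 1)

/-- `|∇f|²` for a real-valued function `f`. -/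
def gradSqR (f : Pt → ℝ) (x : Pt) : ℝ :=
  ∑ i, (pdR f x i) ^ 2

/-- Laplacian of a real-valued function. -/
def lapR (f : Pt → ℝ) (x : Pt) : ℝ :=
  ∑ i, fderiv ℝ (fun y => pdR f y i) x (EuclideanSpace.single i 1)

/-- The continuous slope that vanishes on `[-δ, δ]` and equals `1` outside `[-2δ, 2δ]`. -/
def shrinkSlope (δ s : ℝ) : ℝ := min 1 (max 0 (|s| / δ - 1))

/-- A `C¹` soft threshold: it vanishes on `[-δ, δ]` and stays within `2δ` of the identity. -/
def shrink (δ s : ℝ) : ℝ := ∫ t in (0 : ℝ)..s, shrinkSlope δ t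

lemma continuous_shrinkSlope (δ : ℝ) : Continuous (shrinkSlope δ) := by
  unfold shrinkSlope; fun_prop

lemma shrinkSlope_nonneg (δ s : ℝ) : 0 ≤ shrinkSlope δ s := by
  unfold shrinkSlope; positivity

lemma shrinkSlope_le_one (δ s : ℝ) : shrinkSlope δ s ≤ 1 := min_le_left _ _

lemma shrinkSlope_eq_zero {δ s : ℝ} (hδ : 0 < δ) (hs : |s| ≤ δ) : shrinkSlope δ s = 0 := by
  have : |s| / δ - 1 ≤ 0 := by
    rw [sub_nonpos, div_le_one hδ]; exact hs
  simp [shrinkSlope, max_eq_left this]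

lemma shrinkSlope_eq_one {δ s : ℝ} (hδ : 0 < δ) (hs : 2 * δ ≤ |s|) : shrinkSlope δ s = 1 := by
  have : 1 ≤ |s| / δ - 1 := by
    rw [le_sub_iff_add_le, le_div_iff₀ hδ]; linarith
  exact min_eq_left (this.trans (le_max_right _ _))

lemma hasDerivAt_shrink (δ s : ℝ) : HasDerivAt (shrink δ) (shrinkSlope δ s) s :=
  (continuous_shrinkSlope δ).integral_hasStrictDerivAt 0 s |>.hasDerivAt

lemma contDiff_shrink (δ : ℝ) : ContDiff ℝ 1 (shrink δ) := by
  rw [contDiff_one_iff_deriv]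
  refine ⟨fun s => (hasDerivAt_shrink δ s).differentiableAt, ?_⟩
  rw [show deriv (shrink δ) = shrinkSlope δ from funext fun s => (hasDerivAt_shrink δ s).deriv]
  exact continuous_shrinkSlope δ

lemma shrink_neg (δ s : ℝ) : shrink δ (-s) = -shrink δ s := by
  have h := intervalIntegral.integral_comp_neg (a := 0) (b := s) (shrinkSlope δ)
  have he : ∀ t, shrinkSlope δ (-t) = shrinkSlope δ t := fun t => by simp [shrinkSlope]
  simp only [he, neg_zero] at h
  rw [shrink, shrink, h, intervalIntegral.integral_symm]

lemma shrink_bounds_of_nonneg {δ s : ℝ} (hδ : 0 < δ) (hs : 0 ≤ s) :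
    0 ≤ shrink δ s ∧ shrink δ s ≤ s ∧ s - 2 * δ ≤ shrink δ s := by
  have hi : ∀ a b, IntervalIntegrable (shrinkSlope δ) volume a b := fun a b =>
    (continuous_shrinkSlope δ).intervalIntegrable a b
  have h0 : ∀ {r}, 0 ≤ r → 0 ≤ shrink δ r := fun hr =>
    intervalIntegral.integral_nonneg hr fun t _ => shrinkSlope_nonneg δ t
  refine ⟨h0 hs, ?_, ?_⟩
  · have := intervalIntegral.integral_mono_on hs (hi 0 s) (intervalIntegrable_const (c := (1 : ℝ)))
      fun t _ => shrinkSlope_le_one δ t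
    simpa [shrink] using this
  · rcases le_total s (2 * δ) with h | h
    · linarith [h0 hs]
    · have h1 := intervalIntegral.integral_add_adjacent_intervals (hi 0 (2 * δ)) (hi (2 * δ) s)
      have h2 : ∫ t in (2 * δ)..s, shrinkSlope δ t = ∫ t in (2 * δ)..s, (1 : ℝ) := by
        refine intervalIntegral.integral_congr fun t ht => ?_
        rw [Set.uIcc_of_le h] at ht
        exact shrinkSlope_eq_one hδ (ht.1.trans (le_abs_self t))
      have h3 := h0 (r := 2 * δ) (by linarith)
      simp only [intervalIntegral.integral_const, smul_eq_mul, mul_one] at h2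
      unfold shrink at h3 ⊢
      linarith

lemma shrink_eq_zero {δ s : ℝ} (hδ : 0 < δ) (hs : |s| ≤ δ) : shrink δ s = 0 := by
  have : shrink δ s = ∫ t in (0 : ℝ)..s, (0 : ℝ) := by
    refine intervalIntegral.integral_congr fun t ht => shrinkSlope_eq_zero hδ ?_
    have := Set.abs_sub_left_of_mem_uIcc ht
    simp only [sub_zero] at this
    exact this.trans hs
  simpa using this

lemma integrableOn_of_compact_support {Ω K : Set Pt} (hΩ : IsOpen Ω) (hK : IsCompact K)
    (hKΩ : K ⊆ Ω) {f : Pt → ℝ} (hf : ContinuousOn f Ω) (h0 : ∀ x ∈ Ω, x ∉ K → f x = 0) :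
    IntegrableOn f Ω :=
  ((hf.mono hKΩ).integrableOn_compact hK).of_forall_sdiff_eq_zero hΩ.measurableSet
    fun x hx => h0 x hx.1 hx.2

lemma contDiff_indicator_of_compact_support {Ω K : Set Pt} (hΩ : IsOpen Ω) (hK : IsCompact K)
    {f : Pt → ℝ} (hf : ContDiffOn ℝ 1 f Ω) (h0 : ∀ x ∈ Ω, x ∉ K → f x = 0)
    (hKΩ : K ⊆ Ω) : ContDiff ℝ 1 (Ω.indicator f) := by
  rw [contDiff_iff_contDiffAt]
  intro x
  by_cases hx : x ∈ Ω
  · refine (hf.contDiffAt (hΩ.mem_nhds hx)).congr_of_eventuallyEq ?_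
    filter_upwards [hΩ.mem_nhds hx] with y hy using Set.indicator_of_mem hy f
  · refine (contDiffAt_const (c := (0 : ℝ))).congr_of_eventuallyEq ?_
    filter_upwards [hK.isClosed.isOpen_compl.mem_nhds fun h => hx (hKΩ h)] with y hy
    by_cases hyΩ : y ∈ Ω
    · rw [Set.indicator_of_mem hyΩ, h0 y hyΩ hy]
    · rw [Set.indicator_of_notMem hyΩ]

lemma hasCompactSupport_indicator {Ω K : Set Pt} (hK : IsCompact K)
    {f : Pt → ℝ} (h0 : ∀ x ∈ Ω, x ∉ K → f x = 0) : HasCompactSupport (Ω.indicator f) :=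
  HasCompactSupport.intro hK fun x hx => by
    by_cases hxΩ : x ∈ Ω
    · rw [Set.indicator_of_mem hxΩ, h0 x hxΩ hx]
    · rw [Set.indicator_of_notMem hxΩ]

lemma fderiv_indicator_of_mem {Ω : Set Pt} (hΩ : IsOpen Ω) (f : Pt → ℝ) {x : Pt} (hx : x ∈ Ω) :
    fderiv ℝ (Ω.indicator f) x = fderiv ℝ f x := by
  refine Filter.EventuallyEq.fderiv_eq ?_
  filter_upwards [hΩ.mem_nhds hx] with y hy using Set.indicator_of_mem hy f

lemma integral_fderiv_eq_zero_of_hasCompactSupport {f : Pt → ℝ} (hf : ContDiff ℝ 1 f)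
    (hs : HasCompactSupport f) (v : Pt) : ∫ x, fderiv ℝ f x v = 0 := by
  have hc : Continuous fun x => fderiv ℝ f x v :=
    (hf.continuous_fderiv one_ne_zero).clm_apply continuous_const
  have hi : Integrable fun x => fderiv ℝ f x v :=
    hc.integrable_of_hasCompactSupport (hs.fderiv_apply ℝ v)
  have h := integral_mul_fderiv_eq_neg_fderiv_mul_of_integrable (μ := (volume : Measure Pt))
    (f := f) (g := fun _ => (1 : ℝ)) (v := v)
    (by simpa using hi) (by simp)
    (by simpa using hf.continuous.integrable_of_hasCompactSupport hs)
    (fun x _ => hf.differentiable one_ne_zero x) (fun x _ => differentiableAt_const _)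
  simpa using h

lemma setIntegral_fderiv_eq_zero {Ω K : Set Pt} (hΩ : IsOpen Ω) (hK : IsCompact K)
    (hKΩ : K ⊆ Ω) {f : Pt → ℝ} (hf : ContDiffOn ℝ 1 f Ω) (h0 : ∀ x ∈ Ω, x ∉ K → f x = 0)
    (v : Pt) : ∫ x in Ω, fderiv ℝ f x v = 0 := by
  have h := integral_fderiv_eq_zero_of_hasCompactSupport
    (contDiff_indicator_of_compact_support hΩ hK hf h0 hKΩ) (hasCompactSupport_indicator hK h0) v
  have h1 : ∀ x ∉ Ω, fderiv ℝ (Ω.indicator f) x v = 0 := by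
    intro x hx
    have : Ω.indicator f =ᶠ[𝓝 x] fun _ => (0 : ℝ) := by
      filter_upwards [hK.isClosed.isOpen_compl.mem_nhds fun h => hx (hKΩ h)] with y hy
      by_cases hyΩ : y ∈ Ω
      · rw [Set.indicator_of_mem hyΩ, h0 y hyΩ hy]
      · rw [Set.indicator_of_notMem hyΩ]
    rw [this.fderiv_eq]; simp
  rw [← h, ← setIntegral_eq_integral_of_forall_compl_eq_zero h1]
  exact setIntegral_congr_fun hΩ.measurableSet fun x hx => by
    simp only [fderiv_indicator_of_mem hΩ f hx]

/-- The gradient of a function that is `C¹` up to the boundary is bounded. -/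
lemma exists_norm_fderiv_le {F : Type*} [NormedAddCommGroup F] [NormedSpace ℝ F]
    {Ω : Set Pt} (hΩ : IsOpen Ω) (hb : Bornology.IsBounded Ω)
    {f : Pt → F} (hf : ContDiffOn ℝ 1 f (closure Ω)) :
    ∃ M : ℝ, ∀ x ∈ Ω, ‖fderiv ℝ f x‖ ≤ M := by
  have hK : IsCompact (closure Ω) := hb.isCompact_closure
  suffices ∃ M : ℝ, ∀ x ∈ closure Ω ∩ Ω, ‖fderiv ℝ f x‖ ≤ M by
    obtain ⟨M, hM⟩ := this
    exact ⟨M, fun x hx => hM x ⟨subset_closure hx, hx⟩⟩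
  refine hK.induction_on (p := fun S => ∃ M : ℝ, ∀ x ∈ S ∩ Ω, ‖fderiv ℝ f x‖ ≤ M)
    ⟨0, by simp⟩ ?_ ?_ ?_
  · rintro s t hst ⟨M, hM⟩
    exact ⟨M, fun x hx => hM x ⟨hst hx.1, hx.2⟩⟩
  · rintro s t ⟨M, hM⟩ ⟨N, hN⟩
    refine ⟨max M N, fun x hx => ?_⟩
    rcases hx.1 with h | h
    · exact (hM x ⟨h, hx.2⟩).trans (le_max_left _ _)
    · exact (hN x ⟨h, hx.2⟩).trans (le_max_right _ _)
  · intro x hx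
    have h := (hf x hx)
    rw [show (1 : WithTop ℕ∞) = 0 + 1 by simp,
      contDiffWithinAt_succ_iff_hasFDerivWithinAt (by simp)] at h
    obtain ⟨s, hs, -, f', hf', hc⟩ := h
    rw [Set.insert_eq_of_mem hx] at hs
    have hxs : x ∈ s := mem_of_mem_nhdsWithin hx hs
    have hc' : ContinuousWithinAt f' s x := hc.continuousWithinAt
    have hlt : ∀ᶠ y in 𝓝[s] x, ‖f' y‖ < ‖f' x‖ + 1 :=
      hc'.norm.eventually_lt_const (by linarith)
    have hlt' : ∀ᶠ y in 𝓝[closure Ω] x, ‖f' y‖ < ‖f' x‖ + 1 :=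
      nhdsWithin_le_of_mem hs hlt
    have hs' : ∀ᶠ y in 𝓝[closure Ω] x, s ∈ 𝓝[closure Ω] y := eventually_mem_nhdsWithin_iff.2 hs
    refine ⟨{y | ‖f' y‖ < ‖f' x‖ + 1 ∧ s ∈ 𝓝[closure Ω] y}, hlt'.and hs', ‖f' x‖ + 1, ?_⟩
    rintro y ⟨⟨hy1, hy2⟩, hyΩ⟩
    rw [nhdsWithin_eq_nhds.2 (mem_of_superset (hΩ.mem_nhds hyΩ) subset_closure)] at hy2
    rw [((hf' y (mem_of_mem_nhds hy2)).hasFDerivAt hy2).fderiv]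
    exact hy1.le

/-- Ladyzhenskaya's inequality in the plane. -/
lemma exists_ladyzhenskaya_const : ∃ C : ℝ, 0 ≤ C ∧ ∀ v : Pt → ℝ, ContDiff ℝ 1 v →
    HasCompactSupport v →
      ∫ x, v x ^ 4 ≤ C * ((∫ x, v x ^ 2) * ∫ x, ‖fderiv ℝ v x‖ ^ 2) := by
  set C₀ : NNReal := lintegralPowLePowLIntegralFDerivConst (volume : Measure Pt) 2
  refine ⟨4 * C₀, by positivity, fun v hv hs => ?_⟩
  have hvc := hv.continuous
  have hDc : Continuous fun x => ‖fderiv ℝ v x‖ := (hv.continuous_fderiv one_ne_zero).norm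
  have hDs : HasCompactSupport fun x => ‖fderiv ℝ v x‖ := (hs.fderiv ℝ).norm
  have hp : Real.HolderConjugate (Module.finrank ℝ Pt) 2 := by
    simpa using Real.HolderConjugate.two_two
  have hv2 : ContDiff ℝ 1 fun x => v x ^ 2 := hv.pow 2
  have hs2 : HasCompactSupport fun x => v x ^ 2 :=
    hs.comp_left (g := fun t : ℝ => t ^ 2) (by simp)
  have hgn := lintegral_pow_le_pow_lintegral_fderiv (volume : Measure Pt) hv2 hs2 hp
  have hD2 : ∀ x, fderiv ℝ (fun x => v x ^ 2) x = (2 * v x) • fderiv ℝ v x := fun x => by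
    have := ((hv.differentiable one_ne_zero x).hasFDerivAt.pow 2).fderiv
    simpa using this
  have hI4 : Integrable fun x => v x ^ 4 :=
    (by fun_prop : Continuous fun x => v x ^ 4).integrable_of_hasCompactSupport
      (hs.comp_left (g := fun t : ℝ => t ^ 4) (by simp))
  have hI1 : Integrable fun x => 2 * (|v x| * ‖fderiv ℝ v x‖) :=
    (by fun_prop : Continuous fun x => 2 * (|v x| * ‖fderiv ℝ v x‖)).integrable_of_hasCompactSupport
      ((hDs.mul_left (f := fun x => |v x|)).mul_left (f := fun _ => (2 : ℝ)))
  have e1 : ∫⁻ x, ‖v x ^ 2‖ₑ ^ (2 : ℝ) = ENNReal.ofReal (∫ x, v x ^ 4) := by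
    rw [ofReal_integral_eq_lintegral_ofReal hI4 (ae_of_all _ fun x => by positivity)]
    refine lintegral_congr fun x => ?_
    rw [Real.enorm_eq_ofReal (sq_nonneg _), ENNReal.ofReal_rpow_of_nonneg (sq_nonneg _) (by simp)]
    congr 1
    norm_cast
    ring
  have e2 : ∫⁻ x, ‖fderiv ℝ (fun x => v x ^ 2) x‖ₑ =
      ENNReal.ofReal (∫ x, 2 * (|v x| * ‖fderiv ℝ v x‖)) := by
    rw [ofReal_integral_eq_lintegral_ofReal hI1 (ae_of_all _ fun x => by positivity)]
    refine lintegral_congr fun x => ?_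
    rw [hD2, ← ofReal_norm, norm_smul, norm_mul, Real.norm_eq_abs, Real.norm_eq_abs,
      abs_two, mul_assoc]
  rw [e1, e2, ENNReal.ofReal_rpow_of_nonneg (integral_nonneg fun x => by positivity) (by simp),
    ← ENNReal.ofReal_coe_nnreal, ← ENNReal.ofReal_mul (by positivity),
    ENNReal.ofReal_le_ofReal_iff (by positivity), integral_const_mul] at hgn
  have hcs := integral_mul_le_Lp_mul_Lq_of_nonneg (μ := (volume : Measure Pt))
    Real.HolderConjugate.two_two (f := fun x => |v x|) (g := fun x => ‖fderiv ℝ v x‖)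
    (ae_of_all _ fun x => by positivity) (ae_of_all _ fun x => by positivity)
    (hvc.abs.memLp_of_hasCompactSupport hs.norm) (hDc.memLp_of_hasCompactSupport hDs)
  simp only [Real.rpow_two, sq_abs, ← Real.sqrt_eq_rpow] at hcs hgn
  have h0 : 0 ≤ ∫ x, |v x| * ‖fderiv ℝ v x‖ := integral_nonneg fun x => by positivity
  have hA : 0 ≤ ∫ x, v x ^ 2 := integral_nonneg fun x => by positivity
  have hB : 0 ≤ ∫ x, ‖fderiv ℝ v x‖ ^ 2 := integral_nonneg fun x => by positivity
  have hsq := pow_le_pow_left₀ h0 hcs 2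
  rw [mul_pow, Real.sq_sqrt hA, Real.sq_sqrt hB] at hsq
  calc ∫ x, v x ^ 4 ≤ C₀ * (2 * ∫ x, |v x| * ‖fderiv ℝ v x‖) ^ 2 := hgn
    _ = 4 * C₀ * (∫ x, |v x| * ‖fderiv ℝ v x‖) ^ 2 := by ring
    _ ≤ _ := by gcongr

lemma norm_fderiv_sq_le (f : Pt → ℝ) (x : Pt) : ‖fderiv ℝ f x‖ ^ 2 ≤ 2 * gradSqR f x := by
  have h : ‖fderiv ℝ f x‖ ≤ |pdR f x 0| + |pdR f x 1| := by
    refine ContinuousLinearMap.opNorm_le_bound _ (by positivity) fun y => ?_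
    have hy : y = y 0 • EuclideanSpace.single 0 (1 : ℝ) + y 1 • EuclideanSpace.single 1 (1 : ℝ) := by
      ext i; fin_cases i <;> simp
    have h0 := PiLp.norm_apply_le y 0
    have h1 := PiLp.norm_apply_le y 1
    rw [Real.norm_eq_abs] at h0 h1
    calc ‖fderiv ℝ f x y‖ = |y 0 * pdR f x 0 + y 1 * pdR f x 1| := by
          conv_lhs => rw [hy]
          simp [pdR]
      _ ≤ |y 0| * |pdR f x 0| + |y 1| * |pdR f x 1| := by
          rw [← abs_mul, ← abs_mul]; exact abs_add_le _ _
      _ ≤ ‖y‖ * |pdR f x 0| + ‖y‖ * |pdR f x 1| := by gcongr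
      _ = _ := by ring
  have h2 := pow_le_pow_left₀ (norm_nonneg _) h 2
  rw [gradSqR, Fin.sum_univ_two]
  nlinarith [sq_nonneg (|pdR f x 0| - |pdR f x 1|), sq_abs (pdR f x 0), sq_abs (pdR f x 1)]

lemma gradSqR_nonneg (f : Pt → ℝ) (x : Pt) : 0 ≤ gradSqR f x :=
  Finset.sum_nonneg fun _ _ => sq_nonneg _

lemma gradSq_nonneg (f : Pt → ℂ) (x : Pt) : 0 ≤ gradSq f x :=
  Finset.sum_nonneg fun _ _ => sq_nonneg _

lemma contDiffOn_pdR {Ω : Set Pt} (hΩ : IsOpen Ω) {w : Pt → ℝ} (hw : ContDiffOn ℝ 2 w Ω)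
    (i : Fin 2) : ContDiffOn ℝ 1 (fun x => pdR w x i) Ω :=
  (hw.fderiv_of_isOpen hΩ (by norm_num)).clm_apply contDiffOn_const

lemma contDiffOn_pd {Ω : Set Pt} (hΩ : IsOpen Ω) {w : Pt → ℂ} (hw : ContDiffOn ℝ 2 w Ω)
    (i : Fin 2) : ContDiffOn ℝ 1 (fun x => pd w x i) Ω :=
  (hw.fderiv_of_isOpen hΩ (by norm_num)).clm_apply contDiffOn_const

lemma continuousOn_pd {Ω : Set Pt} (hΩ : IsOpen Ω) {w : Pt → ℂ} (hw : ContDiffOn ℝ 1 w Ω)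
    (i : Fin 2) : ContinuousOn (fun x => pd w x i) Ω :=
  (hw.continuousOn_fderiv_of_isOpen hΩ le_rfl).clm_apply continuousOn_const

lemma continuousOn_gradSq {Ω : Set Pt} (hΩ : IsOpen Ω) {w : Pt → ℂ} (hw : ContDiffOn ℝ 1 w Ω) :
    ContinuousOn (gradSq w) Ω :=
  continuousOn_finsetSum _ fun i _ => (continuousOn_pd hΩ hw i).norm.pow 2

lemma isCompact_superlevel {Ω : Set Pt} (hb : Bornology.IsBounded Ω) {w : Pt → ℝ}
    (hwc : ContinuousOn w (closure Ω)) (δ : ℝ) : IsCompact {x ∈ closure Ω | δ ≤ |w x|} :=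
  hb.isCompact_closure.of_isClosed_subset
    (hwc.abs.preimage_isClosed_of_isClosed isClosed_closure isClosed_Ici) fun _ hx => hx.1

lemma superlevel_subset {Ω : Set Pt} (hΩ : IsOpen Ω) {w : Pt → ℝ}
    (hw0 : ∀ x ∈ frontier Ω, w x = 0) {δ : ℝ} (hδ : 0 < δ) :
    {x ∈ closure Ω | δ ≤ |w x|} ⊆ Ω := by
  rintro x ⟨hx, hxδ⟩
  by_contra hxΩ
  have := hw0 x (by rw [hΩ.frontier_eq]; exact ⟨hx, hxΩ⟩)
  rw [this, abs_zero] at hxδ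
  linarith

/-- Green's formula for `w` tested against its soft threshold. -/
lemma integral_slope_mul_gradSqR {Ω : Set Pt} (hΩ : IsOpen Ω) (hb : Bornology.IsBounded Ω)
    {w : Pt → ℝ} (hwc : ContinuousOn w (closure Ω)) (hw : ContDiffOn ℝ 2 w Ω)
    (hw0 : ∀ x ∈ frontier Ω, w x = 0) {δ : ℝ} (hδ : 0 < δ) :
    IntegrableOn (fun x => shrinkSlope δ (w x) * gradSqR w x) Ω ∧
    IntegrableOn (fun x => shrink δ (w x) * lapR w x) Ω ∧
    ∫ x in Ω, shrinkSlope δ (w x) * gradSqR w x = -∫ x in Ω, shrink δ (w x) * lapR w x := by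
  have hK := isCompact_superlevel hb hwc δ
  have hKΩ := superlevel_subset hΩ hw0 hδ
  set K := {x ∈ closure Ω | δ ≤ |w x|}
  have hKlt : ∀ x ∈ Ω, x ∉ K → |w x| ≤ δ := fun x hx hxK =>
    le_of_not_ge fun h => hxK ⟨subset_closure hx, h⟩
  have hs : ContDiffOn ℝ 1 (fun x => shrink δ (w x)) Ω :=
    (contDiff_shrink δ).comp_contDiffOn (hw.of_le (by norm_num))
  have hsl : ContinuousOn (fun x => shrinkSlope δ (w x)) Ω :=
    (continuous_shrinkSlope δ).comp_continuousOn hw.continuousOn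
  have hp := contDiffOn_pdR hΩ hw
  have hpp : ∀ i, ContinuousOn
      (fun x => fderiv ℝ (fun y => pdR w y i) x (EuclideanSpace.single i 1)) Ω := fun i =>
    ((hp i).continuousOn_fderiv_of_isOpen hΩ le_rfl).clm_apply continuousOn_const
  have hi1 : IntegrableOn (fun x => shrinkSlope δ (w x) * gradSqR w x) Ω := by
    refine integrableOn_of_compact_support hΩ hK hKΩ
      (hsl.mul (continuousOn_finsetSum _ fun i _ => (hp i).continuousOn.pow 2)) fun x hx hxK => ?_
    rw [shrinkSlope_eq_zero hδ (hKlt x hx hxK), zero_mul]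
  have hi2 : IntegrableOn (fun x => shrink δ (w x) * lapR w x) Ω := by
    refine integrableOn_of_compact_support hΩ hK hKΩ
      (hs.continuousOn.mul (continuousOn_finsetSum _ fun i _ => hpp i)) fun x hx hxK => ?_
    rw [shrink_eq_zero hδ (hKlt x hx hxK), zero_mul]
  refine ⟨hi1, hi2, ?_⟩
  have hF : ∀ i, ∀ x ∈ Ω,
      fderiv ℝ (fun y => shrink δ (w y) * pdR w y i) x (EuclideanSpace.single i 1) =
        shrinkSlope δ (w x) * pdR w x i ^ 2 +
        shrink δ (w x) * fderiv ℝ (fun y => pdR w y i) x (EuclideanSpace.single i 1) := by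
    intro i x hx
    have hwx : DifferentiableAt ℝ w x :=
      (hw.differentiableOn two_ne_zero).differentiableAt (hΩ.mem_nhds hx)
    have hpx : DifferentiableAt ℝ (fun y => pdR w y i) x :=
      ((hp i).differentiableOn one_ne_zero).differentiableAt (hΩ.mem_nhds hx)
    have h := (((hasDerivAt_shrink δ (w x)).comp_hasFDerivAt x hwx.hasFDerivAt).mul
      hpx.hasFDerivAt).fderiv
    rw [show (fun y => shrink δ (w y) * pdR w y i) = (shrink δ ∘ w) * fun y => pdR w y i from rfl, h]
    simp [pdR]
    ring
  have hz : ∀ i, ∫ x in Ω,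
      fderiv ℝ (fun y => shrink δ (w y) * pdR w y i) x (EuclideanSpace.single i 1) = 0 := fun i =>
    setIntegral_fderiv_eq_zero hΩ hK hKΩ (hs.mul (hp i)) (fun x hx hxK => by
      rw [shrink_eq_zero hδ (hKlt x hx hxK), zero_mul]) _
  have hFi : ∀ i, IntegrableOn (fun x =>
      fderiv ℝ (fun y => shrink δ (w y) * pdR w y i) x (EuclideanSpace.single i 1)) Ω := fun i => by
    refine integrableOn_of_compact_support hΩ hK hKΩ
      (((hs.mul (hp i)).continuousOn_fderiv_of_isOpen hΩ le_rfl).clm_apply continuousOn_const)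
      fun x hx hxK => ?_
    rw [hF i x hx, shrink_eq_zero hδ (hKlt x hx hxK), shrinkSlope_eq_zero hδ (hKlt x hx hxK)]
    simp
  rw [eq_neg_iff_add_eq_zero, ← integral_add hi1 hi2]
  calc _ = ∫ x in Ω, ∑ i,
        fderiv ℝ (fun y => shrink δ (w y) * pdR w y i) x (EuclideanSpace.single i 1) := by
        refine setIntegral_congr_fun hΩ.measurableSet fun x hx => ?_
        simp only [gradSqR, lapR, Finset.sum_congr rfl fun i _ => hF i x hx,
          Finset.sum_add_distrib, Finset.mul_sum]
    _ = 0 := by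
        rw [integral_finsetSum _ fun i _ => hFi i]
        exact Finset.sum_eq_zero fun i _ => hz i

lemma integral_shrink_pow_four_le {C : ℝ} (hC0 : 0 ≤ C)
    (hC : ∀ v : Pt → ℝ, ContDiff ℝ 1 v → HasCompactSupport v →
      ∫ x, v x ^ 4 ≤ C * ((∫ x, v x ^ 2) * ∫ x, ‖fderiv ℝ v x‖ ^ 2))
    {Ω : Set Pt} (hΩ : IsOpen Ω) (hb : Bornology.IsBounded Ω)
    {w : Pt → ℝ} (hwc : ContinuousOn w (closure Ω)) (hw : ContDiffOn ℝ 2 w Ω)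
    (hw0 : ∀ x ∈ frontier Ω, w x = 0) {δ : ℝ} (hδ : 0 < δ) :
    ∫ x in Ω, shrink δ (w x) ^ 4 ≤ C * ((∫ x in Ω, shrink δ (w x) ^ 2) *
      (2 * ∫ x in Ω, shrinkSlope δ (w x) * gradSqR w x)) := by
  have hK := isCompact_superlevel hb hwc δ
  have hKΩ := superlevel_subset hΩ hw0 hδ
  set K := {x ∈ closure Ω | δ ≤ |w x|}
  have h0 : ∀ x ∈ Ω, x ∉ K → shrink δ (w x) = 0 := fun x hx hxK =>
    shrink_eq_zero hδ (le_of_not_ge fun h => hxK ⟨subset_closure hx, h⟩)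
  have hs : ContDiffOn ℝ 1 (fun x => shrink δ (w x)) Ω :=
    (contDiff_shrink δ).comp_contDiffOn (hw.of_le (by norm_num))
  set V : Pt → ℝ := Ω.indicator fun x => shrink δ (w x) with hV
  have hVc : ContDiff ℝ 1 V := contDiff_indicator_of_compact_support hΩ hK hs h0 hKΩ
  have hVs : HasCompactSupport V := hasCompactSupport_indicator hK h0
  have hpow : ∀ n ≠ 0, ∫ x, V x ^ n = ∫ x in Ω, shrink δ (w x) ^ n := fun n hn => by
    rw [← integral_indicator hΩ.measurableSet]
    congr 1 with x
    by_cases hx : x ∈ Ω <;> simp [hV, hx, hn]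
  have hD0 : ∀ x ∉ Ω, ‖fderiv ℝ V x‖ ^ 2 = 0 := by
    intro x hx
    have hxt : x ∉ tsupport V := fun h => hx (hKΩ (closure_minimal (fun y hy => by
      by_contra hyK
      refine hy ?_
      by_cases hyΩ : y ∈ Ω
      · rw [hV, Set.indicator_of_mem hyΩ, h0 y hyΩ hyK]
      · rw [hV, Set.indicator_of_notMem hyΩ]) hK.isClosed h))
    rw [fderiv_of_notMem_tsupport ℝ hxt]; simp
  have hDc : Continuous fun x => ‖fderiv ℝ V x‖ := (hVc.continuous_fderiv one_ne_zero).norm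
  have hDi : Integrable fun x => ‖fderiv ℝ V x‖ ^ 2 :=
    (by fun_prop : Continuous fun x => ‖fderiv ℝ V x‖ ^ 2).integrable_of_hasCompactSupport
      ((hVs.fderiv ℝ).norm.comp_left (g := fun t : ℝ => t ^ 2) (by simp))
  have hD : ∫ x, ‖fderiv ℝ V x‖ ^ 2 ≤ 2 * ∫ x in Ω, shrinkSlope δ (w x) * gradSqR w x := by
    rw [← setIntegral_eq_integral_of_forall_compl_eq_zero hD0, ← integral_const_mul]
    refine setIntegral_mono_on hDi.integrableOn
      ((integral_slope_mul_gradSqR hΩ hb hwc hw hw0 hδ).1.const_mul 2) hΩ.measurableSet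
      fun x hx => ?_
    have hwx : DifferentiableAt ℝ w x :=
      (hw.differentiableOn two_ne_zero).differentiableAt (hΩ.mem_nhds hx)
    have h := ((hasDerivAt_shrink δ (w x)).comp_hasFDerivAt x hwx.hasFDerivAt).fderiv
    rw [hV, fderiv_indicator_of_mem hΩ _ hx, show (fun y => shrink δ (w y)) = shrink δ ∘ w from rfl,
      h, norm_smul, Real.norm_of_nonneg (shrinkSlope_nonneg _ _), mul_pow]
    have a0 := shrinkSlope_nonneg δ (w x)
    have a1 := shrinkSlope_le_one δ (w x)
    calc shrinkSlope δ (w x) ^ 2 * ‖fderiv ℝ w x‖ ^ 2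
        ≤ shrinkSlope δ (w x) * (2 * gradSqR w x) := by
          gcongr
          · nlinarith
          · exact norm_fderiv_sq_le w x
      _ = _ := by ring
  have h := hC V hVc hVs
  rw [hpow 4 (by norm_num), hpow 2 (by norm_num)] at h
  refine h.trans ?_
  gcongr

/-- The equation satisfied by `1 - |U|²`. -/
lemma lapR_one_sub_norm_sq {Ω : Set Pt} (hΩ : IsOpen Ω) {U : Pt → ℂ} (hU : ContDiffOn ℝ 2 U Ω)
    {x : Pt} (hx : x ∈ Ω) :
    lapR (fun y => 1 - ‖U y‖ ^ 2) x = -2 * gradSq U x - 2 * inner ℝ (U x) (lap U x) := by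
  have hUd : ∀ y ∈ Ω, HasFDerivAt U (fderiv ℝ U y) y := fun y hy =>
    ((hU.differentiableOn two_ne_zero).differentiableAt (hΩ.mem_nhds hy)).hasFDerivAt
  have hp1 : ∀ i, ∀ y ∈ Ω, pdR (fun z => 1 - ‖U z‖ ^ 2) y i = -2 * inner ℝ (U y) (pd U y i) := by
    intro i y hy
    rw [pdR, ((hUd y hy).norm_sq.const_sub 1).fderiv]
    simp [pd]
    ring
  have hp2 : ∀ i, fderiv ℝ (fun y => pdR (fun z => 1 - ‖U z‖ ^ 2) y i) x
      (EuclideanSpace.single i 1) = -2 * ‖pd U x i‖ ^ 2 -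
        2 * inner ℝ (U x) (fderiv ℝ (fun y => pd U y i) x (EuclideanSpace.single i 1)) := by
    intro i
    have hev : (fun y => pdR (fun z => 1 - ‖U z‖ ^ 2) y i) =ᶠ[𝓝 x]
        fun y => -2 * inner ℝ (U y) (pd U y i) := by
      filter_upwards [hΩ.mem_nhds hx] with y hy using hp1 i y hy
    have hpd : HasFDerivAt (fun y => pd U y i) (fderiv ℝ (fun y => pd U y i) x) x :=
      (((contDiffOn_pd hΩ hU i).differentiableOn one_ne_zero).differentiableAt
        (hΩ.mem_nhds hx)).hasFDerivAt
    rw [hev.fderiv_eq, (((hUd x hx).inner ℝ hpd).const_mul (-2)).fderiv]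
    have : fderiv ℝ U x (EuclideanSpace.single i 1) = pd U x i := rfl
    simp only [smul_apply, ContinuousLinearMap.comp_apply,
      ContinuousLinearMap.prod_apply, fderivInnerCLM_apply, this, real_inner_self_eq_norm_sq,
      smul_eq_mul]
    ring
  rw [lapR, Finset.sum_congr rfl fun i _ => hp2 i, gradSq, lap, inner_sum, Finset.sum_sub_distrib,
    Finset.mul_sum, Finset.mul_sum]

lemma shrink_sq_le {δ w : ℝ} (hδ : 0 < δ) (hδ' : 8 * δ ≤ 1) (hw : w ≤ 1) :
    w ^ 2 ≤ 2 * shrink δ w ^ 2 + 8 * δ ^ 2 ∧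
    shrink δ w ^ 2 ≤ 4 * ((1 - w) * (w * shrink δ w)) + 2 * shrink δ w ^ 4 ∧
    shrink δ w ≤ max w 0 ∧ shrink δ w ^ 2 ≤ w ^ 2 := by
  rcases le_total 0 w with h | h
  · obtain ⟨h0, h1, h2⟩ := shrink_bounds_of_nonneg hδ h
    set s := shrink δ w
    refine ⟨?_, ?_, h1.trans (le_max_left _ _), by gcongr⟩
    · nlinarith [sq_nonneg (s - 2 * δ)]
    · have h3 : (1 - s - 2 * δ) * s ^ 2 ≤ (1 - w) * (w * s) :=
        calc (1 - s - 2 * δ) * s ^ 2 ≤ (1 - w) * s ^ 2 := by gcongr ?_ * _; linarith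
          _ ≤ (1 - w) * (w * s) := by
            rw [sq]
            gcongr
      nlinarith [mul_nonneg (sq_nonneg s) (sq_nonneg (1 - s)),
        mul_nonneg (sq_nonneg s) (sub_nonneg.2 hδ')]
  · obtain ⟨h0, h1, h2⟩ := shrink_bounds_of_nonneg (s := -w) hδ (by linarith)
    rw [shrink_neg] at h0 h1 h2
    set s := shrink δ w
    have hws : s ^ 2 ≤ w * s := by nlinarith
    refine ⟨?_, ?_, le_trans (by linarith) (le_max_right _ _), by nlinarith⟩
    · nlinarith [sq_nonneg (s + 2 * δ)]
    · have : w * s ≤ (1 - w) * (w * s) := by nlinarith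
      nlinarith [sq_nonneg (s ^ 2)]

lemma norm_pd_le (u : Pt → ℂ) (x : Pt) (i : Fin 2) : ‖pd u x i‖ ≤ ‖fderiv ℝ u x‖ := by
  have := (fderiv ℝ u x).le_opNorm (EuclideanSpace.single i 1)
  simpa [pd] using this

lemma exists_gradSq_le {Ω : Set Pt} (hΩ : IsOpen Ω) (hb : Bornology.IsBounded Ω)
    {U : Pt → ℂ} (hU : ContDiffOn ℝ 1 U (closure Ω)) :
    ∃ B : ℝ, ∀ x ∈ Ω, gradSq U x ≤ B := by
  obtain ⟨M, hM⟩ := exists_norm_fderiv_le hΩ hb hU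
  refine ⟨2 * M ^ 2, fun x hx => ?_⟩
  have h : ∀ i, ‖pd U x i‖ ^ 2 ≤ M ^ 2 := fun i =>
    pow_le_pow_left₀ (norm_nonneg _) ((norm_pd_le U x i).trans (hM x hx)) 2
  rw [gradSq, Fin.sum_univ_two]
  linarith [h 0, h 1]

lemma continuousOn_one_sub_norm_sq {s : Set Pt} {U : Pt → ℂ} (hU : ContinuousOn U s) :
    ContinuousOn (fun x => 1 - ‖U x‖ ^ 2) s :=
  continuousOn_const.sub (hU.norm.pow 2)

lemma integrableOn_of_continuousOn_closure {Ω : Set Pt} (hb : Bornology.IsBounded Ω) {f : Pt → ℝ}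
    (hf : ContinuousOn f (closure Ω)) : IntegrableOn f Ω :=
  (hf.integrableOn_compact hb.isCompact_closure).mono_set subset_closure

lemma integrableOn_of_bounded {Ω : Set Pt} (hΩ : IsOpen Ω) (hb : Bornology.IsBounded Ω)
    {f : Pt → ℝ} (hf : ContinuousOn f Ω) {B : ℝ} (hB : ∀ x ∈ Ω, ‖f x‖ ≤ B) :
    IntegrableOn f Ω := by
  have : IsFiniteMeasure (volume.restrict Ω) := ⟨by simpa using hb.measure_lt_top⟩
  exact Integrable.of_bound (hf.aestronglyMeasurable hΩ.measurableSet) B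
    (ae_restrict_of_forall_mem hΩ.measurableSet hB)

lemma integrableOn_gradSq_mul_pos_part {Ω : Set Pt} (hΩ : IsOpen Ω) (hb : Bornology.IsBounded Ω)
    {U : Pt → ℂ} (hU : ContDiffOn ℝ 1 U (closure Ω)) :
    IntegrableOn (fun x => gradSq U x * max (1 - ‖U x‖ ^ 2) 0) Ω := by
  obtain ⟨B, hB⟩ := exists_gradSq_le hΩ hb hU
  refine integrableOn_of_bounded hΩ hb (B := B * 1)
    ((continuousOn_gradSq hΩ (hU.mono subset_closure)).mul
      ((continuousOn_one_sub_norm_sq (hU.continuousOn.mono subset_closure)).sup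
        continuousOn_const)) fun x hx => ?_
  have h0 := gradSq_nonneg U x
  rw [Real.norm_of_nonneg (by positivity)]
  have h1 : max (1 - ‖U x‖ ^ 2) 0 ≤ 1 := max_le (by linarith [sq_nonneg ‖U x‖]) zero_le_one
  have := hB x hx
  gcongr
  exact h0.trans this

/-- The potential energy is controlled by `∫ |∇U|² (1 - |U|²)⁺`. -/
lemma potential_le {C : ℝ} (hC0 : 0 ≤ C)
    (hC : ∀ v : Pt → ℝ, ContDiff ℝ 1 v → HasCompactSupport v →
      ∫ x, v x ^ 4 ≤ C * ((∫ x, v x ^ 2) * ∫ x, ‖fderiv ℝ v x‖ ^ 2))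
    {Ω : Set Pt} (hΩ : IsOpen Ω) (hb : Bornology.IsBounded Ω) {U : Pt → ℂ}
    (hU1 : ContDiffOn ℝ 1 U (closure Ω)) (hU2 : ContDiffOn ℝ 2 U Ω) {a : ℝ} (ha : 0 ≤ a)
    (hGL : ∀ x ∈ Ω, -(lap U x) = (a : ℂ) * U x * ((1 - ‖U x‖ ^ 2 : ℝ) : ℂ))
    (hUb : ∀ x ∈ frontier Ω, ‖U x‖ = 1) {δ : ℝ} (hδ : 0 < δ) (hδ' : 8 * δ ≤ 1) :
    a * ∫ x in Ω, (1 - ‖U x‖ ^ 2) ^ 2 ≤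
      (8 + 16 * C * (a * ∫ x in Ω, (1 - ‖U x‖ ^ 2) ^ 2)) *
        (∫ x in Ω, gradSq U x * max (1 - ‖U x‖ ^ 2) 0) + 8 * a * δ ^ 2 * volume.real Ω := by
  have hwc : ContinuousOn (fun x => 1 - ‖U x‖ ^ 2) (closure Ω) :=
    continuousOn_one_sub_norm_sq hU1.continuousOn
  have hw2 : ContDiffOn ℝ 2 (fun x => 1 - ‖U x‖ ^ 2) Ω := contDiffOn_const.sub (hU2.norm_sq ℝ)
  have hw0 : ∀ x ∈ frontier Ω, (fun x => 1 - ‖U x‖ ^ 2) x = 0 := fun x hx => by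
    simp [hUb x hx]
  have hI := integrableOn_gradSq_mul_pos_part hΩ hb hU1
  have hlap : ∀ x ∈ Ω, lapR (fun y => 1 - ‖U y‖ ^ 2) x =
      -2 * gradSq U x + 2 * a * (‖U x‖ ^ 2 * (1 - ‖U x‖ ^ 2)) := by
    intro x hx
    have h1 : lap U x = (-(a * (1 - ‖U x‖ ^ 2)) : ℝ) • U x := by
      rw [← neg_neg (lap U x), hGL x hx, Complex.real_smul]
      push_cast; ring
    rw [lapR_one_sub_norm_sq hΩ hU2 hx, h1, inner_smul_right, real_inner_self_eq_norm_sq]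
    ring
  obtain ⟨-, hL, hgreen⟩ := integral_slope_mul_gradSqR hΩ hb hwc hw2 hw0 hδ
  have hlady := integral_shrink_pow_four_le hC0 hC hΩ hb hwc hw2 hw0 hδ
  have hw1 : ∀ x, 1 - ‖U x‖ ^ 2 ≤ 1 := fun x => by linarith [sq_nonneg ‖U x‖]
  set w : Pt → ℝ := fun x => 1 - ‖U x‖ ^ 2 with hw
  have hsc : ContinuousOn (fun x => shrink δ (w x)) (closure Ω) :=
    (contDiff_shrink δ).continuous.comp_continuousOn hwc
  have hb1 := fun x => shrink_sq_le hδ hδ' (hw1 x)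
  have hwi : IntegrableOn (fun x => w x ^ 2) Ω :=
    integrableOn_of_continuousOn_closure hb (hwc.pow 2)
  have hs2 : IntegrableOn (fun x => shrink δ (w x) ^ 2) Ω :=
    integrableOn_of_continuousOn_closure hb (hsc.pow 2)
  have hs4 : IntegrableOn (fun x => shrink δ (w x) ^ 4) Ω :=
    integrableOn_of_continuousOn_closure hb (hsc.pow 4)
  have hq : IntegrableOn (fun x => (1 - w x) * (w x * shrink δ (w x))) Ω :=
    integrableOn_of_continuousOn_closure hb ((continuousOn_const.sub hwc).mul (hwc.mul hsc))
  have hconst : IntegrableOn (fun _ : Pt => 8 * δ ^ 2) Ω :=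
    integrableOn_of_continuousOn_closure hb continuousOn_const
  set I := ∫ x in Ω, gradSq U x * max (w x) 0 with hIdef
  set A := ∫ x in Ω, shrinkSlope δ (w x) * gradSqR w x
  set Q := ∫ x in Ω, (1 - w x) * (w x * shrink δ (w x)) with hQdef
  set P := ∫ x in Ω, w x ^ 2
  have hA0 : 0 ≤ A := integral_nonneg fun x =>
    mul_nonneg (shrinkSlope_nonneg _ _) (gradSqR_nonneg _ _)
  have hQ0 : 0 ≤ Q := integral_nonneg fun x => by
    have h1 := hb1 x
    have h2 : 0 ≤ 1 - w x := by linarith [hw1 x]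
    rcases le_total 0 (w x) with h | h
    · exact mul_nonneg h2 (mul_nonneg h (shrink_bounds_of_nonneg hδ h).1)
    · refine mul_nonneg h2 (mul_nonneg_of_nonpos_of_nonpos h ?_)
      exact h1.2.2.1.trans_eq (max_eq_right h)
  have henergy : A + 2 * a * Q ≤ 2 * I := by
    have hmono := setIntegral_mono_on hL.neg ((hI.const_mul 2).sub (hq.const_mul (2 * a)))
      hΩ.measurableSet fun x hx => by
        have h1 := mul_le_mul_of_nonneg_left (hb1 x).2.2.1 (gradSq_nonneg U x)
        simp only [Pi.neg_apply, Pi.sub_apply]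
        rw [hlap x hx]
        simp only [hw] at h1 ⊢
        linarith
    simp only [Pi.neg_apply, Pi.sub_apply] at hmono
    rw [integral_neg, integral_sub (hI.const_mul 2) (hq.const_mul (2 * a)), integral_const_mul,
      integral_const_mul] at hmono
    rw [hgreen]
    linarith
  have h1 : P ≤ 2 * (∫ x in Ω, shrink δ (w x) ^ 2) + 8 * δ ^ 2 * volume.real Ω := by
    have := setIntegral_mono hwi ((hs2.const_mul 2).add hconst) fun x => (hb1 x).1
    simp only [Pi.add_apply] at this
    rw [integral_add (hs2.const_mul 2) hconst, integral_const_mul, setIntegral_const] at this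
    simpa [mul_comm] using this
  have h2 : ∫ x in Ω, shrink δ (w x) ^ 2 ≤ 4 * Q + 2 * ∫ x in Ω, shrink δ (w x) ^ 4 := by
    have := setIntegral_mono hs2 ((hq.const_mul 4).add (hs4.const_mul 2)) fun x => (hb1 x).2.1
    simp only [Pi.add_apply] at this
    rwa [integral_add (hq.const_mul 4) (hs4.const_mul 2), integral_const_mul,
      integral_const_mul] at this
  have h3 : ∫ x in Ω, shrink δ (w x) ^ 2 ≤ P :=
    setIntegral_mono hs2 hwi fun x => (hb1 x).2.2.2
  have hP0 : 0 ≤ P := integral_nonneg fun x => sq_nonneg _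
  have h4 : ∫ x in Ω, shrink δ (w x) ^ 4 ≤ C * (P * (4 * I)) := by
    refine hlady.trans ?_
    have : 2 * A ≤ 4 * I := by nlinarith [mul_nonneg ha hQ0]
    gcongr
  have h5 : a * Q ≤ I := by linarith
  have h6 : a * P ≤ a * (2 * (4 * Q + 2 * (C * (P * (4 * I)))) + 8 * δ ^ 2 * volume.real Ω) := by
    gcongr
    linarith
  nlinarith [h6, h5]

lemma integral_gradSq_mul_pos_part_le {Ω : Set Pt} (hΩ : IsOpen Ω) (hb : Bornology.IsBounded Ω)
    {U U₀ : Pt → ℂ} (hU : ContDiffOn ℝ 1 U (closure Ω)) (hU₀ : ContDiffOn ℝ 1 U₀ (closure Ω))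
    {B : ℝ} (hB0 : 0 ≤ B) (hB : ∀ x ∈ Ω, gradSq U₀ x ≤ B) {ε : ℝ} (hε : 0 < ε) :
    ∫ x in Ω, gradSq U x * max (1 - ‖U x‖ ^ 2) 0 ≤
      2 * (∫ x in Ω, gradDiffSq U U₀ x) +
        B * ε * (volume.real Ω + (ε ^ 2)⁻¹ * ∫ x in Ω, (1 - ‖U x‖ ^ 2) ^ 2) := by
  have hi1 : IntegrableOn (gradDiffSq U U₀) Ω := by
    obtain ⟨D, hD⟩ := exists_gradSq_le hΩ hb hU
    refine integrableOn_of_bounded hΩ hb (B := 2 * D + 2 * B) (continuousOn_finsetSum _ fun i _ =>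
      ((continuousOn_pd hΩ (hU.mono subset_closure) i).sub
        (continuousOn_pd hΩ (hU₀.mono subset_closure) i)).norm.pow 2) fun x hx => ?_
    have h0 : 0 ≤ gradDiffSq U U₀ x := Finset.sum_nonneg fun _ _ => sq_nonneg _
    rw [Real.norm_of_nonneg h0]
    have h1 := hB x hx
    have h2 := hD x hx
    have h3 : ∀ i, ‖pd U x i - pd U₀ x i‖ ^ 2 ≤ 2 * ‖pd U x i‖ ^ 2 + 2 * ‖pd U₀ x i‖ ^ 2 :=
      fun i => by
        have := pow_le_pow_left₀ (norm_nonneg _) (norm_sub_le (pd U x i) (pd U₀ x i)) 2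
        nlinarith [sq_nonneg (‖pd U x i‖ - ‖pd U₀ x i‖)]
    rw [gradSq, Fin.sum_univ_two] at h1 h2
    rw [gradDiffSq, Fin.sum_univ_two]
    linarith [h3 0, h3 1]
  have hi2 : IntegrableOn (fun x => (1 - ‖U x‖ ^ 2) ^ 2) Ω :=
    integrableOn_of_continuousOn_closure hb
      ((continuousOn_one_sub_norm_sq hU.continuousOn).pow 2)
  have hi3 : IntegrableOn (fun _ : Pt => B * ε) Ω :=
    integrableOn_of_continuousOn_closure hb continuousOn_const
  have hpt : ∀ x ∈ Ω, gradSq U x * max (1 - ‖U x‖ ^ 2) 0 ≤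
      2 * gradDiffSq U U₀ x + (B * ε + B * ε * (ε ^ 2)⁻¹ * (1 - ‖U x‖ ^ 2) ^ 2) := by
    intro x hx
    have h1 : gradSq U x ≤ 2 * gradDiffSq U U₀ x + 2 * B := by
      have h3 : ∀ i, ‖pd U x i‖ ^ 2 ≤
          2 * ‖pd U x i - pd U₀ x i‖ ^ 2 + 2 * ‖pd U₀ x i‖ ^ 2 := fun i => by
        have := norm_add_le (pd U x i - pd U₀ x i) (pd U₀ x i)
        rw [sub_add_cancel] at this
        have := pow_le_pow_left₀ (norm_nonneg _) this 2
        nlinarith [sq_nonneg (‖pd U x i - pd U₀ x i‖ - ‖pd U₀ x i‖)]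
      have h2 := hB x hx
      rw [gradSq, Fin.sum_univ_two] at h2 ⊢
      rw [gradDiffSq, Fin.sum_univ_two]
      linarith [h3 0, h3 1]
    have h0 : 0 ≤ gradDiffSq U U₀ x := Finset.sum_nonneg fun _ _ => sq_nonneg _
    have hm0 : 0 ≤ max (1 - ‖U x‖ ^ 2) 0 := le_max_right _ _
    have hm1 : max (1 - ‖U x‖ ^ 2) 0 ≤ 1 := max_le (by linarith [sq_nonneg ‖U x‖]) zero_le_one
    have hm2 : 2 * max (1 - ‖U x‖ ^ 2) 0 ≤ ε + ε * (ε ^ 2)⁻¹ * (1 - ‖U x‖ ^ 2) ^ 2 := by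
      have hsq : ε + ε * (ε ^ 2)⁻¹ * (1 - ‖U x‖ ^ 2) ^ 2 - 2 * (1 - ‖U x‖ ^ 2) =
          ε⁻¹ * (ε - (1 - ‖U x‖ ^ 2)) ^ 2 := by
        field_simp
        ring
      have : 0 ≤ ε⁻¹ * (ε - (1 - ‖U x‖ ^ 2)) ^ 2 := by positivity
      rcases max_cases (1 - ‖U x‖ ^ 2) 0 with ⟨h, -⟩ | ⟨h, -⟩ <;> rw [h]
      · linarith
      · rw [mul_zero]; positivity
    calc gradSq U x * max (1 - ‖U x‖ ^ 2) 0
        ≤ (2 * gradDiffSq U U₀ x + 2 * B) * max (1 - ‖U x‖ ^ 2) 0 := by gcongr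
      _ = 2 * gradDiffSq U U₀ x * max (1 - ‖U x‖ ^ 2) 0 + B * (2 * max (1 - ‖U x‖ ^ 2) 0) := by
          ring
      _ ≤ 2 * gradDiffSq U U₀ x * 1 + B * (ε + ε * (ε ^ 2)⁻¹ * (1 - ‖U x‖ ^ 2) ^ 2) := by
          gcongr
      _ = _ := by ring
  have h := setIntegral_mono_on (integrableOn_gradSq_mul_pos_part hΩ hb hU)
    ((hi1.const_mul 2).add (hi3.add (hi2.const_mul (B * ε * (ε ^ 2)⁻¹)))) hΩ.measurableSet hpt
  refine h.trans_eq ?_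
  have e1 := integral_add (hi1.const_mul 2) (hi3.add (hi2.const_mul (B * ε * (ε ^ 2)⁻¹)))
  have e2 := integral_add hi3 (hi2.const_mul (B * ε * (ε ^ 2)⁻¹))
  simp only [Pi.add_apply] at e1 e2 ⊢
  rw [e1, e2, integral_const_mul, setIntegral_const, smul_eq_mul, integral_const_mul (B * ε * (ε ^ 2)⁻¹)]
  ring

/-- Theorem 1.2, the other direction: `H¹` convergence of `u_ε` to `u₀` implies that
the rescaled potential vanishes in the limit. -/
theorem stmt3
    (Ω : Set Pt) (hΩo : IsOpen Ω) (hΩne : Ω.Nonempty) (hΩconn : IsConnected Ω)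
    (hΩbdd : Bornology.IsBounded Ω)
    (g : Pt → ℂ) (hg : ∀ x ∈ frontier Ω, ‖g x‖ = 1)
    (φ : Pt → ℝ) (hφ1 : ContDiffOn ℝ 1 φ (closure Ω)) (hφ2 : ContDiffOn ℝ 2 φ Ω)
    (hφharm : ∀ x ∈ Ω, lapR φ x = 0)
    (u₀ : Pt → ℂ) (hu₀ : ∀ x, u₀ x = Complex.exp (Complex.I * (φ x : ℂ)))
    (hu₀b : ∀ x ∈ frontier Ω, u₀ x = g x)
    (u : ℝ → Pt → ℂ)
    (hu1 : ∀ ε > 0, ContDiffOn ℝ 1 (u ε) (closure Ω))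
    (hu2 : ∀ ε > 0, ContDiffOn ℝ 2 (u ε) Ω)
    (hGL : ∀ ε > 0, ∀ x ∈ Ω,
      -(lap (u ε) x) = ((ε ^ 2 : ℝ) : ℂ)⁻¹ * u ε x * ((1 - ‖u ε x‖ ^ 2 : ℝ) : ℂ))
    (hub : ∀ ε > 0, ∀ x ∈ frontier Ω, u ε x = g x)
    (hpoho : ∃ γ₀ > 0, ∀ᶠ ε in 𝓝[>] (0 : ℝ),
      (ε ^ 2)⁻¹ * (∫ x in Ω, (1 - ‖u ε x‖ ^ 2) ^ 2) ≤ γ₀)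
    (hH1a : Tendsto (fun ε => ∫ x in Ω, ‖u ε x - u₀ x‖ ^ 2) (𝓝[>] (0 : ℝ)) (𝓝 0))
    (hH1b : Tendsto (fun ε => ∫ x in Ω, gradDiffSq (u ε) u₀ x) (𝓝[>] (0 : ℝ)) (𝓝 0)) :
    Tendsto (fun ε => (ε ^ 2)⁻¹ * ∫ x in Ω, (1 - ‖u ε x‖ ^ 2) ^ 2) (𝓝[>] (0 : ℝ)) (𝓝 0) := by
  obtain ⟨C, hC0, hC⟩ := exists_ladyzhenskaya_const
  obtain ⟨γ₀, hγ₀, hpoho⟩ := hpoho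
  have hu₀1 : ContDiffOn ℝ 1 u₀ (closure Ω) := by
    rw [show u₀ = fun x => Complex.exp (Complex.I * (φ x : ℂ)) from funext hu₀]
    exact (contDiffOn_const.mul (Complex.ofRealCLM.contDiff.comp_contDiffOn hφ1)).cexp
  obtain ⟨B, hB⟩ := exists_gradSq_le hΩo hΩbdd hu₀1
  obtain ⟨x₀, hx₀⟩ := hΩne
  have hB0 : 0 ≤ B := (gradSq_nonneg u₀ x₀).trans (hB x₀ hx₀)
  have hε : Tendsto (fun ε : ℝ => ε) (𝓝[>] 0) (𝓝 0) := tendsto_nhdsWithin_of_tendsto_nhds tendsto_id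
  have hbound : Tendsto (fun ε : ℝ => (8 + 16 * C * γ₀) *
      (2 * (∫ x in Ω, gradDiffSq (u ε) u₀ x) + B * ε * (volume.real Ω + γ₀)) +
        8 * ε ^ 2 * volume.real Ω) (𝓝[>] 0) (𝓝 0) := by
    have := ((((hH1b.const_mul 2).add ((hε.const_mul B).mul_const (volume.real Ω + γ₀))).const_mul
      (8 + 16 * C * γ₀))).add (((hε.pow 2).const_mul 8).mul_const (volume.real Ω))
    simpa using this
  refine tendsto_of_tendsto_of_tendsto_of_le_of_le' tendsto_const_nhds hbound ?_ ?_
  · exact Eventually.of_forall fun ε => mul_nonneg (by positivity)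
      (integral_nonneg fun x => sq_nonneg _)
  · have hsmall : ∀ᶠ ε : ℝ in 𝓝[>] 0, ε < 1 / 8 := hε.eventually_lt_const (by norm_num)
    filter_upwards [hpoho, hsmall, self_mem_nhdsWithin] with ε hP hε8 hεpos
    replace hεpos : 0 < ε := hεpos
    have h1 := potential_le hC0 hC hΩo hΩbdd (hu1 ε hεpos) (hu2 ε hεpos)
      (a := (ε ^ 2)⁻¹) (by positivity) (by simpa using hGL ε hεpos)
      (fun x hx => by rw [hub ε hεpos x hx, hg x hx]) (δ := ε ^ 2) (by positivity) (by nlinarith)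
    have h2 := integral_gradSq_mul_pos_part_le hΩo hΩbdd (hu1 ε hεpos) hu₀1 hB0 hB hεpos
    have hI0 : 0 ≤ ∫ x in Ω, gradSq (u ε) x * max (1 - ‖u ε x‖ ^ 2) 0 :=
      integral_nonneg fun x => mul_nonneg (gradSq_nonneg _ _) (le_max_right _ _)
    refine h1.trans ?_
    have h3 : 8 * (ε ^ 2)⁻¹ * (ε ^ 2) ^ 2 = 8 * ε ^ 2 := by field_simp
    rw [h3]
    gcongr
    refine h2.trans ?_
    gcongr
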